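/- Let (b_n)_{n≥1} be the paperfolding sequence. For every integer k ≥ 1, (2^(4k+1) − 2^(2k))·∑_{n≥1} (2b_n − 1)/n^(2k+1) = −(2^(2k−1)/(2k)!)·π^(2k+1)·|E_{2k}|, where E_{2k} is the 2k-th Euler number. -/

import Mathlib

/-- Even-index Euler numbers: `E2 k = E_{2k}`, where `1/cosh t = ∑ E_n t^n/n!`
(equivalently, `E_0 = 1`, odd-index Euler numbers vanish, and
`∑_{j≤n} C(2n,2j) E_{2j} = 0` for `n ≥ 1`). -/
def E2 : ℕ → ℤ
  | 0 => 1
  | n + 1 => -∑ k ∈ (Finset.range (n+1)).attach,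
      ((2*(n+1)).choose (2*k.1) : ℤ) * E2 k.1
decreasing_by exact Finset.mem_range.mp k.2

/-- Thue–Morse sequence: `tm 0 = 0`, `tm (2n) = tm n`, `tm (2n+1) = 1 - tm n`. -/
def tm : ℕ → ℕ
  | 0 => 0
  | n + 1 => if (n+1) % 2 = 0 then tm ((n+1)/2) else 1 - tm ((n+1)/2)
decreasing_by all_goals exact Nat.div_lt_self (Nat.succ_pos n) one_lt_two

/-- Paperfolding (dragon-curve) sequence: `pf (2n) = pf n`, `pf (4n+1) = 0`,
`pf (4n+3) = 1` (with `pf 0 = 0`). -/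
def pf : ℕ → ℕ
  | 0 => 0
  | n + 1 => if (n+1) % 2 = 0 then pf ((n+1)/2) else if (n+1) % 4 = 1 then 0 else 1
decreasing_by exact Nat.div_lt_self (Nat.succ_pos n) one_lt_two

open Finset Polynomial in
/-- The Bernoulli polynomials form an Appell sequence. -/
theorem bernoulli_eval_add_div_factorial (n : ℕ) (x y : ℚ) :
    (Polynomial.bernoulli n).eval (x + y) / n.factorial =
      ∑ p ∈ antidiagonal n,
        (Polynomial.bernoulli p.1).eval x / p.1.factorial * (y ^ p.2 / p.2.factorial) := by
  have hne : PowerSeries.exp ℚ - 1 ≠ 0 := fun h => by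
    simpa [PowerSeries.coeff_exp, PowerSeries.coeff_one] using congr(PowerSeries.coeff 1 $h)
  have key : (PowerSeries.mk fun n =>
        aeval (x + y) ((1 / n.factorial : ℚ) • Polynomial.bernoulli n)) =
      (PowerSeries.mk fun n => aeval x ((1 / n.factorial : ℚ) • Polynomial.bernoulli n)) *
        PowerSeries.rescale y (PowerSeries.exp ℚ) := by
    apply mul_right_cancel₀ hne
    rw [mul_right_comm, bernoulli_generating_function, bernoulli_generating_function,
      ← PowerSeries.exp_mul_exp_eq_exp_add, mul_assoc]
  have := congr(PowerSeries.coeff n $key)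
  rw [PowerSeries.coeff_mul] at this
  simpa [PowerSeries.coeff_exp, div_eq_inv_mul, coe_aeval_eq_eval, mul_comm, mul_left_comm,
    mul_assoc] using this

theorem sum_range_two_mul {M : Type*} [AddCommMonoid M] (f : ℕ → M) (n : ℕ) :
    ∑ i ∈ Finset.range (2 * n), f i = ∑ i ∈ Finset.range n, (f (2 * i) + f (2 * i + 1)) := by
  induction n with
  | zero => simp
  | succ n ih =>
    rw [mul_add_one, Finset.sum_range_succ, Finset.sum_range_succ, Finset.sum_range_succ, ih,
      add_assoc]

theorem bernoulli_eval_half_odd (n : ℕ) : (Polynomial.bernoulli (2 * n + 1)).eval (1 / 2) = 0 := by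
  have h := Polynomial.bernoulli_eval_one_sub (2 * n + 1) (1 / 2)
  rw [Odd.neg_one_pow ⟨n, rfl⟩] at h
  norm_num at h ⊢
  linarith

open Finset in
theorem sum_bernoulli_eval_quarter_odd {n : ℕ} (hn : n ≠ 0) :
    ∑ i ∈ range (n + 1), (Polynomial.bernoulli (2 * i + 1)).eval (1 / 4) / (2 * i + 1).factorial *
      ((1 / 4) ^ (2 * (n - i)) / (2 * (n - i)).factorial) = 0 := by
  have h₁ := bernoulli_eval_add_div_factorial (2 * n + 1) (1 / 4) (1 / 4)
  have h₂ := bernoulli_eval_add_div_factorial (2 * n + 1) (1 / 4) (-(1 / 4))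
  rw [show (1 / 4 + 1 / 4 : ℚ) = 1 / 2 by norm_num, bernoulli_eval_half_odd] at h₁
  rw [add_neg_cancel, Polynomial.bernoulli_eval_zero,
    bernoulli_eq_zero_of_odd ⟨n, rfl⟩ (by omega)] at h₂
  rw [Nat.sum_antidiagonal_eq_sum_range_succ_mk, Nat.succ_eq_add_one,
    show 2 * n + 1 + 1 = 2 * (n + 1) by ring, sum_range_two_mul] at h₁ h₂
  have h := congr($h₁ + $h₂)
  rw [← sum_add_distrib] at h
  have : ∑ i ∈ range (n + 1), 2 * ((Polynomial.bernoulli (2 * i + 1)).eval (1 / 4) /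
      (2 * i + 1).factorial * ((1 / 4) ^ (2 * (n - i)) / (2 * (n - i)).factorial)) = 0 := by
    rw [zero_div, add_zero] at h
    rw [h]
    refine sum_congr rfl fun i hi => ?_
    have hi' : i ≤ n := by simpa [Nat.lt_succ_iff] using hi
    rw [show 2 * n + 1 - 2 * i = 2 * (n - i) + 1 by omega,
      show 2 * n + 1 - (2 * i + 1) = 2 * (n - i) by omega,
      Odd.neg_pow ⟨n - i, rfl⟩, Even.neg_pow (even_two_mul _)]
    ring
  rwa [← mul_sum, mul_eq_zero_iff_left two_ne_zero] at this

open Finset in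
theorem E2_succ (n : ℕ) :
    E2 (n + 1) = -∑ k ∈ range (n + 1), ((2 * (n + 1)).choose (2 * k) : ℤ) * E2 k := by
  rw [E2, sum_attach (range (n + 1)) fun k => ((2 * (n + 1)).choose (2 * k) : ℤ) * E2 k]

open Finset in
theorem bernoulli_eval_quarter_odd (n : ℕ) :
    (Polynomial.bernoulli (2 * n + 1)).eval (1 / 4) = -(2 * n + 1) * E2 n / 4 ^ (2 * n + 1) := by
  induction n using Nat.strong_induction_on with
  | _ n ih =>
    cases n with
    | zero => norm_num [E2]
    | succ n =>
      have h := sum_bernoulli_eval_quarter_odd n.succ_ne_zero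
      have hterm : ∀ i ∈ range (n + 1),
          (Polynomial.bernoulli (2 * i + 1)).eval (1 / 4) / (2 * i + 1).factorial *
            ((1 / 4) ^ (2 * (n + 1 - i)) / (2 * (n + 1 - i)).factorial) =
          -(1 / (4 ^ (2 * (n + 1) + 1) * (2 * (n + 1)).factorial)) *
            (((2 * (n + 1)).choose (2 * i) : ℚ) * E2 i) := by
        intro i hi
        have hi' := mem_range.mp hi
        rw [ih i hi', Nat.cast_choose ℚ (show 2 * i ≤ 2 * (n + 1) by omega), Nat.factorial_succ,
          ← Nat.mul_sub, one_div_pow]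
        have h4 : (4 : ℚ) ^ (2 * (n + 1) + 1) = 4 ^ (2 * i + 1) * 4 ^ (2 * (n + 1 - i)) := by
          rw [← pow_add]; congr 1; omega
        have : (2 * i + 1 : ℚ) ≠ 0 := by positivity
        have := Nat.factorial_ne_zero (2 * i)
        have := Nat.factorial_ne_zero (2 * (n + 1))
        have := Nat.factorial_ne_zero (2 * (n + 1 - i))
        rw [h4]
        push_cast
        field_simp
      rw [sum_range_succ, sum_congr rfl hterm, ← mul_sum] at h
      have hE : ((E2 (n + 1) : ℤ) : ℚ) =
          -∑ k ∈ range (n + 1), ((2 * (n + 1)).choose (2 * k) : ℚ) * E2 k := by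
        rw [E2_succ]; push_cast; rfl
      rw [← neg_eq_iff_eq_neg] at hE
      rw [← hE, Nat.sub_self, Nat.factorial_succ (2 * (n + 1))] at h
      have := Nat.factorial_ne_zero (2 * (n + 1))
      have : (2 * ((n + 1 : ℕ) : ℚ) + 1) ≠ 0 := by positivity
      push_cast at h this ⊢
      field_simp at h ⊢
      simp only [mul_zero, Nat.factorial_zero, Nat.cast_one] at h
      linarith

theorem sin_two_pi_mul_odd_quarter (m : ℕ) :
    Real.sin (2 * Real.pi * (2 * m + 1 : ℕ) * (1 / 4)) = (-1) ^ m := by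
  rw [show 2 * Real.pi * (2 * m + 1 : ℕ) * (1 / 4) = Real.pi / 2 + m * Real.pi by push_cast; ring,
    Real.sin_add_nat_mul_pi, Real.sin_pi_div_two, mul_one]

/-- Dirichlet's beta function at odd arguments. -/
theorem hasSum_dirichletBeta_odd {k : ℕ} (hk : k ≠ 0) :
    HasSum (fun m : ℕ => (-1 : ℝ) ^ m * (1 / (2 * (m : ℝ) + 1) ^ (2 * k + 1)))
      ((-1) ^ k * Real.pi ^ (2 * k + 1) * E2 k / (2 ^ (2 * k + 2) * (2 * k).factorial)) := by
  have h := hasSum_one_div_nat_pow_mul_sin hk (x := 1 / 4) (by constructor <;> norm_num)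
  have hinj : Function.Injective fun m : ℕ => 2 * m + 1 := fun a b hab => by
    simpa using hab
  rw [← hinj.hasSum_iff] at h
  · convert! h using 1
    · ext m
      simp only [Function.comp_apply]
      rw [sin_two_pi_mul_odd_quarter]
      push_cast
      ring
    · have hb := congr((algebraMap ℚ ℝ) $(bernoulli_eval_quarter_odd k))
      rw [← Polynomial.eval_map_apply] at hb
      simp only [eq_ratCast] at hb
      push_cast at hb
      have h4 : (4 : ℝ) ^ (2 * k + 1) = 2 ^ (2 * k + 1) * 2 ^ (2 * k + 1) := by
        rw [← mul_pow]; norm_num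
      rw [hb, Nat.factorial_succ, h4, mul_pow]
      have : (2 * (k : ℝ) + 1) ≠ 0 := by positivity
      have := Nat.factorial_ne_zero (2 * k)
      push_cast
      field_simp
      ring
  · intro n hn
    obtain ⟨m, rfl⟩ : Even n := by
      by_contra ho
      obtain ⟨m, rfl⟩ := Nat.not_even_iff_odd.mp ho
      exact hn ⟨m, rfl⟩
    rw [show 2 * Real.pi * (m + m : ℕ) * (1 / 4) = m * Real.pi by push_cast; ring,
      Real.sin_nat_mul_pi, mul_zero]

theorem hasSum_dirichletBeta_odd_abs {k : ℕ} (hk : k ≠ 0) :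
    HasSum (fun m : ℕ => (-1 : ℝ) ^ m * (1 / (2 * (m : ℝ) + 1) ^ (2 * k + 1)))
      (Real.pi ^ (2 * k + 1) * |(E2 k : ℝ)| / (2 ^ (2 * k + 2) * (2 * k).factorial)) := by
  have h := hasSum_dirichletBeta_odd hk
  have hanti : Antitone fun m : ℕ => 1 / (2 * (m : ℝ) + 1) ^ (2 * k + 1) := by
    intro a b hab
    dsimp only
    gcongr
  have hnonneg := hanti.alternating_series_le_tendsto h.tendsto_sum_nat 0
  simp only [mul_zero, Finset.range_zero, Finset.sum_empty] at hnonneg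
  rw [← abs_of_nonneg hnonneg] at h
  convert h using 1
  rw [abs_div, abs_mul, abs_mul, abs_pow, abs_neg, abs_one, one_pow, one_mul,
    abs_of_pos (by positivity : (0 : ℝ) < Real.pi ^ (2 * k + 1)),
    abs_of_pos (by positivity : (0 : ℝ) < 2 ^ (2 * k + 2) * (2 * k).factorial)]

theorem pf_two_mul (n : ℕ) : pf (2 * (n + 1)) = pf (n + 1) := by
  rw [show 2 * (n + 1) = 2 * n + 1 + 1 by ring, pf, if_pos (by omega)]
  congr 1
  omega

theorem two_mul_pf_sub_one_odd (n : ℕ) : 2 * (pf (2 * n + 1) : ℝ) - 1 = -(-1) ^ n := by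
  rw [pf, if_neg (by omega)]
  rcases Nat.even_or_odd n with h | h
  · rw [if_pos (by have := h.two_dvd; omega), h.neg_one_pow]; norm_num
  · rw [if_neg (by obtain ⟨m, rfl⟩ := h; omega), h.neg_one_pow]; norm_num

theorem pf_le_one (n : ℕ) : pf n ≤ 1 := by
  induction n using Nat.strong_induction_on with
  | _ n ih =>
    cases n with
    | zero => simp [pf]
    | succ n =>
      rw [pf]
      split_ifs
      · exact ih _ (by omega)
      · exact zero_le_one
      · exact le_rfl

theorem summable_pf {s : ℕ} (hs : 1 < s) :
    Summable fun n : ℕ => (2 * (pf (n + 1) : ℝ) - 1) / ((n : ℝ) + 1) ^ s := by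
  have h := (summable_nat_add_iff 1).mpr (Real.summable_one_div_nat_pow.mpr hs)
  refine Summable.of_norm_bounded h fun n => ?_
  have hb : (pf (n + 1) : ℝ) ≤ 1 := mod_cast pf_le_one _
  have hb' : (0 : ℝ) ≤ pf (n + 1) := Nat.cast_nonneg _
  rw [norm_div, norm_pow, Real.norm_of_nonneg (by positivity : (0 : ℝ) ≤ n + 1), Nat.cast_add_one]
  gcongr
  rw [Real.norm_eq_abs, abs_le]
  constructor <;> linarith

theorem tsum_pf {s : ℕ} (hs : 1 < s) {β : ℝ}
    (hβ : HasSum (fun m : ℕ => (-1 : ℝ) ^ m * (1 / (2 * (m : ℝ) + 1) ^ s)) β) :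
    (2 ^ s - 1) * ∑' n : ℕ, (2 * (pf (n + 1) : ℝ) - 1) / ((n : ℝ) + 1) ^ s = -(2 ^ s * β) := by
  have hsum := summable_pf hs
  set T := ∑' n : ℕ, (2 * (pf (n + 1) : ℝ) - 1) / ((n : ℝ) + 1) ^ s
  have heven : HasSum (fun m : ℕ => (2 * (pf (2 * m + 1) : ℝ) - 1) / (((2 * m : ℕ) : ℝ) + 1) ^ s)
      (-β) := by
    convert! hβ.neg using 2 with m
    rw [two_mul_pf_sub_one_odd]
    push_cast
    ring
  have hodd : HasSum
      (fun m : ℕ => (2 * (pf (2 * m + 1 + 1) : ℝ) - 1) / (((2 * m + 1 : ℕ) : ℝ) + 1) ^ s)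
      (T / 2 ^ s) := by
    convert! hsum.hasSum.div_const (2 ^ s) using 2 with m
    rw [add_assoc, ← mul_add_one, pf_two_mul, div_div, ← mul_pow]
    push_cast
    ring
  have h : T = -β + T / 2 ^ s := hsum.hasSum.unique (heven.even_add_odd hodd)
  field_simp at h
  linarith

theorem paperfolding_odd_zeta (k : ℕ) (hk : 1 ≤ k) :
    ((2:ℝ) ^ (4*k+1) - 2 ^ (2*k)) *
        ∑' n : ℕ, (2 * (pf (n+1) : ℝ) - 1) / ((n:ℝ) + 1) ^ (2*k+1) =
      -((2:ℝ) ^ (2*k-1) / (Nat.factorial (2*k))) * Real.pi ^ (2*k+1) * |(E2 k : ℝ)| := by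
  have h := tsum_pf (by omega) (hasSum_dirichletBeta_odd_abs (by omega : k ≠ 0))
  rw [show (2 : ℝ) ^ (4 * k + 1) - 2 ^ (2 * k) = 2 ^ (2 * k) * (2 ^ (2 * k + 1) - 1) by ring,
    mul_assoc, h]
  obtain ⟨j, rfl⟩ := Nat.exists_eq_add_of_le' hk
  rw [show 2 * (j + 1) - 1 = 2 * j + 1 by omega]
  have := Nat.factorial_ne_zero (2 * (j + 1))
  field_simp
  ring
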